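/- Let a : [0, ∞) → ℝ and A : [0, ∞) → M₄(ℝ) be differentiable functions with A(t) structured for all t ≥ 0, satisfying the bracket-flow system a′(t) = p(a(t), A(t))·a(t) and A′(t) = [A(t), P(a(t), A(t))] + p(a(t), A(t))·A(t). Then (d/dt)‖A⁺(t)‖² ≤ −(1/4)·‖A⁺(t)‖⁶ for all t ≥ 0; consequently, if A⁺(0) ≠ 0 then ‖A⁺(t)‖² ≤ ( ‖A⁺(0)‖⁻⁴ + t/2 )^{−1/2} for all t ≥ 0, and in particular A⁺(t) → 0 as t → ∞. -/

import Mathlib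

open Matrix

/-- The standard complex structure matrix `J₁` on `ℝ⁴`. -/
def J1mat : Matrix (Fin 4) (Fin 4) ℝ :=
  !![0, 0, 0, -1;
     0, 0, -1, 0;
     0, 1, 0, 0;
     1, 0, 0, 0]

/-- A real 4×4 matrix is structured if it commutes with `J₁` and is traceless. -/
def Structured (A : Matrix (Fin 4) (Fin 4) ℝ) : Prop :=
  A * J1mat = J1mat * A ∧ A.trace = 0

/-- The inner product `⟨M, N⟩ = tr(MᵀN)` on 4×4 matrices. -/
def mip (M N : Matrix (Fin 4) (Fin 4) ℝ) : ℝ := (Mᵀ * N).trace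

/-- Commutator `[M, N] = MN − NM`. -/
def mbr (M N : Matrix (Fin 4) (Fin 4) ℝ) : Matrix (Fin 4) (Fin 4) ℝ := M * N - N * M

/-- Symmetric part `M⁺ = (M + Mᵀ)/2`. -/
noncomputable def symPart (M : Matrix (Fin 4) (Fin 4) ℝ) : Matrix (Fin 4) (Fin 4) ℝ :=
  (1/2 : ℝ) • (M + Mᵀ)

/-- Antisymmetric part `M⁻ = (M − Mᵀ)/2`. -/
noncomputable def skewPart (M : Matrix (Fin 4) (Fin 4) ℝ) : Matrix (Fin 4) (Fin 4) ℝ :=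
  (1/2 : ℝ) • (M - Mᵀ)

/-- `w(a,A) = 4a² + 4‖A‖² − (tr(J₁A))²`. -/
noncomputable def wfun (a : ℝ) (A : Matrix (Fin 4) (Fin 4) ℝ) : ℝ :=
  4 * a^2 + 4 * mip A A - ((J1mat * A).trace)^2

/-- `p(a,A) = (1/32)·((tr(J₁A²))² − w(a,A)·‖A⁺‖²)`. -/
noncomputable def pfun (a : ℝ) (A : Matrix (Fin 4) (Fin 4) ℝ) : ℝ :=
  (1/32) * (((J1mat * (A * A)).trace)^2 - wfun a A * mip (symPart A) (symPart A))

/-- `P(a,A) = (w(a,A)/32)·[A,Aᵀ] − (a³/2)·A⁺ − (a/2)·[A⁻, AᵀA]`. -/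
noncomputable def Pfun (a : ℝ) (A : Matrix (Fin 4) (Fin 4) ℝ) : Matrix (Fin 4) (Fin 4) ℝ :=
  (wfun a A / 32) • mbr A Aᵀ - (a^3/2) • symPart A - (a/2) • mbr (skewPart A) (Aᵀ * A)

/-- Structured matrices in coordinates adapted to the splitting into symmetric part
(coordinates `x, y, z`) and antisymmetric part (coordinates `k, l, m, n`). -/
def structuredOf (x y z k l m n : ℝ) : Matrix (Fin 4) (Fin 4) ℝ :=
  !![x, y + k, z + l, m;
     y - k, -x, n, l - z;
     z - l, -n, -x, y - k;
     -m, -(z + l), y + k, x]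

lemma Structured.exists_eq_structuredOf {A : Matrix (Fin 4) (Fin 4) ℝ} (h : Structured A) :
    ∃ x y z k l m n : ℝ, A = structuredOf x y z k l m n := by
  obtain ⟨hc, ht⟩ := h
  have e : ∀ i j, (A * J1mat) i j = (J1mat * A) i j := fun i j => by rw [hc]
  simp only [Fin.forall_fin_succ, Matrix.mul_apply, Fin.sum_univ_four, J1mat] at e
  simp at e
  simp only [Matrix.trace, Fin.sum_univ_four, Matrix.diag_apply] at ht
  refine ⟨A 0 0, (A 0 1 + A 1 0) / 2, (A 0 2 - A 1 3) / 2, (A 0 1 - A 1 0) / 2,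
    (A 0 2 + A 1 3) / 2, A 0 3, A 1 2, ?_⟩
  ext i j
  fin_cases i <;> fin_cases j <;> simp [structuredOf] <;> grind

section Coordinates

variable (x y z k l m n : ℝ)

lemma symPart_structuredOf :
    symPart (structuredOf x y z k l m n) = structuredOf x y z 0 0 0 0 := by
  ext i j
  fin_cases i <;> fin_cases j <;> simp [symPart, structuredOf] <;> ring

lemma skewPart_structuredOf :
    skewPart (structuredOf x y z k l m n) = structuredOf 0 0 0 k l m n := by
  ext i j
  fin_cases i <;> fin_cases j <;> simp [skewPart, structuredOf] <;> ring

lemma transpose_structuredOf :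
    (structuredOf x y z k l m n)ᵀ = structuredOf x y z (-k) (-l) (-m) (-n) := by
  ext i j
  fin_cases i <;> fin_cases j <;> simp [structuredOf] <;> ring

lemma mip_structuredOf_self :
    mip (structuredOf x y z k l m n) (structuredOf x y z k l m n) =
      4 * (x ^ 2 + y ^ 2 + z ^ 2 + k ^ 2 + l ^ 2) + 2 * (m ^ 2 + n ^ 2) := by
  simp [mip, structuredOf, Matrix.trace, Fin.sum_univ_four, Matrix.mul_apply]
  ring

lemma wfun_structuredOf (a : ℝ) :
    wfun a (structuredOf x y z k l m n) =
      4 * a ^ 2 + 16 * (x ^ 2 + y ^ 2 + z ^ 2 + k ^ 2 + l ^ 2) + 4 * (m - n) ^ 2 := by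
  rw [wfun, mip_structuredOf_self]
  simp [J1mat, structuredOf, Matrix.trace, Fin.sum_univ_four]
  ring

lemma trace_J1mat_mul_sq_structuredOf :
    (J1mat * (structuredOf x y z k l m n * structuredOf x y z k l m n)).trace =
      4 * (x * (m - n) + 2 * (y * l - z * k)) := by
  simp [J1mat, structuredOf, Matrix.trace, Fin.sum_univ_four]
  ring

lemma mip_symPart_mbr_mbr_transpose :
    mip (structuredOf x y z 0 0 0 0) (mbr (structuredOf x y z k l m n)
      (mbr (structuredOf x y z k l m n) (structuredOf x y z k l m n)ᵀ)) =
      -8 * ((2 * (y * k + z * l)) ^ 2 + (y * (m - n) - 2 * x * l) ^ 2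
        + (z * (m - n) + 2 * x * k) ^ 2) := by
  rw [transpose_structuredOf]
  simp [mip, mbr, structuredOf, Matrix.trace, Fin.sum_univ_four, Matrix.mul_apply]
  ring

lemma mip_symPart_mbr_symPart :
    mip (structuredOf x y z 0 0 0 0) (mbr (structuredOf x y z k l m n)
      (structuredOf x y z 0 0 0 0)) = 0 := by
  simp [mip, mbr, structuredOf, Matrix.trace, Fin.sum_univ_four, Matrix.mul_apply]
  ring

lemma mip_symPart_mbr_mbr_skewPart :
    mip (structuredOf x y z 0 0 0 0) (mbr (structuredOf x y z k l m n)
      (mbr (structuredOf 0 0 0 k l m n)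
        ((structuredOf x y z k l m n)ᵀ * structuredOf x y z k l m n))) = 0 := by
  rw [transpose_structuredOf]
  simp [mip, mbr, structuredOf, Matrix.trace, Fin.sum_univ_four, Matrix.mul_apply]
  ring

end Coordinates

lemma mip_mbr_sub_smul (S A X Y Z B : Matrix (Fin 4) (Fin 4) ℝ) (b c d p : ℝ) :
    mip S (mbr A (b • X - c • Y - d • Z) + p • B) =
      b * mip S (mbr A X) - c * mip S (mbr A Y) - d * mip S (mbr A Z) + p * mip S B := by
  simp only [mip, mbr, mul_add, mul_sub, sub_mul, Matrix.mul_smul, Matrix.smul_mul,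
    Matrix.trace_add, Matrix.trace_sub, Matrix.trace_smul, smul_eq_mul]
  ring

lemma mip_symPart_self_right (M : Matrix (Fin 4) (Fin 4) ℝ) :
    mip (symPart M) M = mip (symPart M) (symPart M) := by
  simp [mip, symPart, Matrix.trace, Fin.sum_univ_four, Matrix.mul_apply]
  ring

/-- The infinitesimal decay estimate for the symmetric part under the bracket flow. -/
lemma Structured.two_mul_mip_symPart_le {A : Matrix (Fin 4) (Fin 4) ℝ} (h : Structured A)
    (a : ℝ) :
    2 * mip (symPart A) (mbr A (Pfun a A) + pfun a A • A) ≤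
      -(1 / 4) * mip (symPart A) (symPart A) ^ 3 := by
  rw [Pfun, mip_mbr_sub_smul, mip_symPart_self_right]
  obtain ⟨x, y, z, k, l, m, n, rfl⟩ := h.exists_eq_structuredOf
  simp only [pfun, symPart_structuredOf, skewPart_structuredOf, mip_symPart_mbr_mbr_transpose,
    mip_symPart_mbr_symPart, mip_symPart_mbr_mbr_skewPart, trace_J1mat_mul_sq_structuredOf,
    mip_structuredOf_self, wfun_structuredOf]
  have key : 0 ≤ 4 * a ^ 2 * (x ^ 2 + y ^ 2 + z ^ 2) ^ 2
      + (4 * (x ^ 2 + y ^ 2 + z ^ 2) + 2 * (1 / 4) *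
          (4 * a ^ 2 + 16 * (x ^ 2 + y ^ 2 + z ^ 2 + k ^ 2 + l ^ 2) + 4 * (m - n) ^ 2)) *
        ((2 * (y * k + z * l)) ^ 2 + (y * (m - n) - 2 * x * l) ^ 2
          + (z * (m - n) + 2 * x * k) ^ 2) := by positivity
  linarith

lemma mip_self_eq_sum (M : Matrix (Fin 4) (Fin 4) ℝ) : mip M M = ∑ i, ∑ j, M i j ^ 2 := by
  simp [mip, Matrix.trace, Fin.sum_univ_four, Matrix.mul_apply]
  ring

lemma mip_self_nonneg (M : Matrix (Fin 4) (Fin 4) ℝ) : 0 ≤ mip M M := by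
  rw [mip_self_eq_sum]
  positivity

lemma sq_apply_le_mip_self (M : Matrix (Fin 4) (Fin 4) ℝ) (i j : Fin 4) :
    M i j ^ 2 ≤ mip M M := by
  rw [mip_self_eq_sum]
  calc M i j ^ 2 ≤ ∑ j, M i j ^ 2 :=
        Finset.single_le_sum (f := fun j => M i j ^ 2) (fun _ _ => sq_nonneg _)
          (Finset.mem_univ j)
    _ ≤ ∑ i, ∑ j, M i j ^ 2 :=
        Finset.single_le_sum (f := fun i => ∑ j, M i j ^ 2)
          (fun _ _ => Finset.sum_nonneg fun _ _ => sq_nonneg _) (Finset.mem_univ i)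

lemma hasDerivAt_mip_symPart {A : ℝ → Matrix (Fin 4) (Fin 4) ℝ} {B : Matrix (Fin 4) (Fin 4) ℝ}
    {t : ℝ} (hA : ∀ i j, HasDerivAt (fun s => A s i j) (B i j) t) :
    HasDerivAt (fun s => mip (symPart (A s)) (symPart (A s)))
      (2 * mip (symPart (A t)) B) t := by
  simp only [mip_self_eq_sum, symPart, Matrix.smul_apply, Matrix.add_apply,
    Matrix.transpose_apply, smul_eq_mul]
  refine (HasDerivAt.fun_sum fun i _ => HasDerivAt.fun_sum fun j _ =>
    (((hA i j).add (hA j i)).const_mul (1 / 2)).pow 2).congr_deriv ?_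
  simp [mip, Matrix.trace, Fin.sum_univ_four, Matrix.mul_apply]
  ring

/-- A nonnegative function with `f' ≤ -f³/4` on `[0, ∞)` is antitone there. -/
lemma antitoneOn_of_deriv_le_neg_cube {f f' : ℝ → ℝ} (hf : ∀ t, 0 ≤ t → HasDerivAt f (f' t) t)
    (hf' : ∀ t, 0 ≤ t → f' t ≤ -(1 / 4) * f t ^ 3) (h0 : ∀ t, 0 ≤ f t) :
    AntitoneOn f (Set.Ici 0) := by
  refine antitoneOn_of_hasDerivWithinAt_nonpos (f' := f') (convex_Ici 0)
    (fun t ht => (hf t ht).continuousAt.continuousWithinAt)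
    (fun t ht => (hf t (interior_subset ht)).hasDerivWithinAt) fun t ht => ?_
  have := hf' t (interior_subset ht)
  have := pow_nonneg (h0 t) 3
  linarith

/-- Comparison for the differential inequality `f' ≤ -f³/4`. -/
lemma le_rpow_of_deriv_le_neg_cube {f f' : ℝ → ℝ} (hf : ∀ t, 0 ≤ t → HasDerivAt f (f' t) t)
    (hf' : ∀ t, 0 ≤ t → f' t ≤ -(1 / 4) * f t ^ 3) (h0 : ∀ t, 0 ≤ f t) {t : ℝ} (ht : 0 ≤ t) :
    f t ≤ ((f 0 ^ 2)⁻¹ + t / 2) ^ (-(1 / 2) : ℝ) := by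
  rcases (h0 t).eq_or_lt with hz | hpos
  · rw [← hz]
    positivity
  have hanti := antitoneOn_of_deriv_le_neg_cube hf hf' h0
  have hfpos : ∀ s ∈ Set.Icc 0 t, 0 < f s := fun s hs =>
    hpos.trans_le (hanti hs.1 ht hs.2)
  have hderiv : ∀ s ∈ Set.Icc 0 t, HasDerivAt (fun s => (f s ^ 2)⁻¹ - s / 2)
      (-(2 * f s * f' s) / (f s ^ 2) ^ 2 - 1 / 2) s := fun s hs => by
    refine ((((hf s hs.1).fun_pow 2).fun_inv (pow_pos (hfpos s hs) 2).ne').fun_sub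
      ((hasDerivAt_id' s).div_const 2)).congr_deriv ?_
    simp
  have hmono : MonotoneOn (fun s => (f s ^ 2)⁻¹ - s / 2) (Set.Icc 0 t) := by
    refine monotoneOn_of_hasDerivWithinAt_nonneg (convex_Icc 0 t)
      (fun s hs => (hderiv s hs).continuousAt.continuousWithinAt)
      (fun s hs => (hderiv s (interior_subset hs)).hasDerivWithinAt) fun s hs => ?_
    have hs := interior_subset hs
    have hp := hfpos s hs
    rw [sub_nonneg, le_div_iff₀ (by positivity)]
    nlinarith [mul_le_mul_of_nonneg_left (hf' s hs.1) hp.le]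
  have hle := hmono (Set.left_mem_Icc.2 ht) (Set.right_mem_Icc.2 ht) ht
  simp only [zero_div, sub_zero] at hle
  have h0pos := hfpos 0 (Set.left_mem_Icc.2 ht)
  calc f t = ((f t ^ 2)⁻¹) ^ (-(1 / 2) : ℝ) := by
        rw [Real.inv_rpow (sq_nonneg _), Real.rpow_neg (sq_nonneg _), inv_inv,
          ← Real.sqrt_eq_rpow, Real.sqrt_sq hpos.le]
    _ ≤ _ := Real.rpow_le_rpow_of_nonpos (by positivity) (by linarith) (by norm_num)

/-- Along solutions of the bracket flow on `[0,∞)`,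
`(d/dt)‖A⁺‖² ≤ −(1/4)‖A⁺‖⁶`; hence if `A⁺(0) ≠ 0` then
`‖A⁺(t)‖² ≤ (‖A⁺(0)‖⁻⁴ + t/2)^{−1/2}` and `A⁺(t) → 0` as `t → ∞`. -/
theorem bracket_flow_symPart_decay
    (a : ℝ → ℝ) (A : ℝ → Matrix (Fin 4) (Fin 4) ℝ)
    (hstr : ∀ t, 0 ≤ t → Structured (A t))
    (ha : ∀ t, 0 ≤ t → HasDerivAt a (pfun (a t) (A t) * a t) t)
    (hA : ∀ t, 0 ≤ t → ∀ i j : Fin 4, HasDerivAt (fun s => A s i j)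
      ((mbr (A t) (Pfun (a t) (A t)) + pfun (a t) (A t) • A t) i j) t) :
    (∀ t, 0 ≤ t → ∃ d : ℝ,
      HasDerivAt (fun s => mip (symPart (A s)) (symPart (A s))) d t ∧
      d ≤ -(1/4) * (mip (symPart (A t)) (symPart (A t)))^3)
    ∧ (symPart (A 0) ≠ 0 → ∀ t, 0 ≤ t →
        mip (symPart (A t)) (symPart (A t)) ≤
          (((mip (symPart (A 0)) (symPart (A 0)))^2)⁻¹ + t/2) ^ (-(1/2) : ℝ))
    ∧ (∀ i j : Fin 4,
        Filter.Tendsto (fun t => symPart (A t) i j) Filter.atTop (nhds 0)) := by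
  have hderiv : ∀ t, 0 ≤ t → HasDerivAt (fun s => mip (symPart (A s)) (symPart (A s)))
      (2 * mip (symPart (A t)) (mbr (A t) (Pfun (a t) (A t)) + pfun (a t) (A t) • A t)) t :=
    fun t ht => hasDerivAt_mip_symPart (hA t ht)
  have hle := fun t (ht : 0 ≤ t) => (hstr t ht).two_mul_mip_symPart_le (a t)
  have hnonneg := fun t => mip_self_nonneg (symPart (A t))
  have hdecay : ∀ t, 0 ≤ t → mip (symPart (A t)) (symPart (A t)) ≤
      (((mip (symPart (A 0)) (symPart (A 0))) ^ 2)⁻¹ + t / 2) ^ (-(1 / 2) : ℝ) :=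
    fun t ht => le_rpow_of_deriv_le_neg_cube hderiv hle hnonneg ht
  refine ⟨fun t ht => ⟨_, hderiv t ht, hle t ht⟩, fun _ => hdecay, fun i j => ?_⟩
  have hlim : Filter.Tendsto (fun t => mip (symPart (A t)) (symPart (A t)))
      Filter.atTop (nhds 0) := by
    refine squeeze_zero' (.of_forall hnonneg)
      ((Filter.eventually_ge_atTop 0).mono hdecay) ?_
    exact (tendsto_rpow_neg_atTop (by norm_num : (0 : ℝ) < 1 / 2)).comp
      (Filter.tendsto_atTop_add_const_left _ _
        (Filter.tendsto_id.atTop_div_const (by norm_num)))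
  have hsq : Filter.Tendsto (fun t => symPart (A t) i j ^ 2) Filter.atTop (nhds 0) :=
    squeeze_zero (fun _ => sq_nonneg _) (fun t => sq_apply_le_mip_self _ i j) hlim
  refine (tendsto_zero_iff_abs_tendsto_zero _).2 ?_
  simpa [Function.comp_def, Real.sqrt_sq_eq_abs] using hsq.sqrt
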